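/- Let q = 2^a with a ≥ 1, K = 𝔽_q((u)), O = 𝔽_q[[u]], and let P₁, P₂ and B = P₁ ∩ P₂ be the standard parahoric and Iwahori subgroups of SL₂(K). Then there do not exist subgroups A₁ ≤ P₁ and A₂ ≤ P₂, each isomorphic to the dihedral group of order 2(q+1), with A₁ ∩ A₂ of order 2, such that for i = 1,2 every element of P_i can be written as a·b with a ∈ A_i and b ∈ B, and A_i ∩ P_{3-i} = A₁ ∩ A₂. -/

import Mathlib

/-- The valuation ring `O = 𝔽_q[[u]]` of `K = 𝔽_q((u))`, regarded as a subring of `K`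
(the image of the ring of formal power series). -/
noncomputable def laurentIntegers (F : Type*) [Field F] : Subring (LaurentSeries F) :=
  (HahnSeries.ofPowerSeries ℤ F).range

/-- The uniformiser `u` of `K = 𝔽_q((u))`. -/
noncomputable def laurentVar (F : Type*) [Field F] : LaurentSeries F :=
  HahnSeries.ofPowerSeries ℤ F PowerSeries.X

/-- The standard parahoric subgroup `P₁` of `SL₂(K)`: matrices all of whose entries lie
in `O`. -/
def parahoricOne (F : Type*) [Field F] :
    Set (Matrix.SpecialLinearGroup (Fin 2) (LaurentSeries F)) :=
  {g | ∀ i j : Fin 2, (↑g : Matrix (Fin 2) (Fin 2) (LaurentSeries F)) i j ∈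
    laurentIntegers F}

/-- The standard parahoric subgroup `P₂` of `SL₂(K)`: matrices whose diagonal entries lie
in `O`, with `u` times the top-right entry in `O`, and bottom-left entry in `u·O`. -/
def parahoricTwo (F : Type*) [Field F] :
    Set (Matrix.SpecialLinearGroup (Fin 2) (LaurentSeries F)) :=
  {g | (↑g : Matrix (Fin 2) (Fin 2) (LaurentSeries F)) 0 0 ∈ laurentIntegers F ∧
       (↑g : Matrix (Fin 2) (Fin 2) (LaurentSeries F)) 1 1 ∈ laurentIntegers F ∧
       laurentVar F * (↑g : Matrix (Fin 2) (Fin 2) (LaurentSeries F)) 0 1 ∈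
         laurentIntegers F ∧
       ∃ y ∈ laurentIntegers F,
         (↑g : Matrix (Fin 2) (Fin 2) (LaurentSeries F)) 1 0 = laurentVar F * y}

/-- The Iwahori subgroup `B = P₁ ∩ P₂`. -/
def iwahori (F : Type*) [Field F] :
    Set (Matrix.SpecialLinearGroup (Fin 2) (LaurentSeries F)) :=
  parahoricOne F ∩ parahoricTwo F

open Matrix

/-- An odd dihedral group is the normal closure of any of its involutions: a homomorphism
killing an involution is trivial. -/
theorem DihedralGroup.map_eq_one_of_odd {n : ℕ} (hn : Odd n) {G : Type*} [Group G]
    (f : DihedralGroup n →* G) {t : DihedralGroup n} (ht : t ≠ 1) (ht2 : t * t = 1)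
    (hft : f t = 1) (x : DihedralGroup n) : f x = 1 := by
  have h2 : IsUnit (2 : ZMod n) := by
    simpa using (ZMod.isUnit_iff_coprime 2 n).2 (Nat.coprime_two_left.2 hn)
  obtain ⟨v, hv⟩ := h2.exists_right_inv
  have hsr : ∀ j, f (.sr j) = 1 := by
    intro j
    rcases t with i | i
    · refine absurd ?_ ht
      have hi : i + i = 0 := by
        simpa [DihedralGroup.one_def, -DihedralGroup.r_zero] using ht2
      have : i = 0 := by linear_combination v * hi - i * hv
      simp [this]
    · have : (DihedralGroup.sr j : DihedralGroup n)
          = .r (v * (i - j)) * .sr i * (.r (v * (i - j)))⁻¹ := by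
        simp only [DihedralGroup.inv_r, DihedralGroup.r_mul_sr, DihedralGroup.sr_mul_r]
        congr 1
        linear_combination (i - j) * hv
      rw [this, map_mul, map_mul, hft, map_inv]
      simp
  rcases x with i | i
  · have : (DihedralGroup.r i : DihedralGroup n) = .sr 0 * .sr i := by simp
    rw [this, map_mul, hsr, hsr, one_mul]
  · exact hsr i

/-- Conjugation of `SL₂` over a field by the diagonal matrix `diag(u, 1)`. -/
noncomputable def Matrix.SpecialLinearGroup.diagConj {K : Type*} [Field K] (u : K) (hu : u ≠ 0) :
    SpecialLinearGroup (Fin 2) K →* SpecialLinearGroup (Fin 2) K where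
  toFun g := ⟨!![g.1 0 0, u * g.1 0 1; u⁻¹ * g.1 1 0, g.1 1 1], by
    have h := g.2
    rw [Matrix.det_fin_two] at h
    rw [Matrix.det_fin_two_of]
    field_simp
    exact h⟩
  map_one' := by
    ext i j
    fin_cases i <;> fin_cases j <;> simp
  map_mul' g h := by
    refine Subtype.ext ?_
    change _ = !![_, _; _, _] * !![_, _; _, _]
    ext i j
    fin_cases i <;> fin_cases j <;>
      simp [Matrix.mul_apply, Fin.sum_univ_two] <;> field_simp

/-- A homomorphism into `SL₂(K)` whose values have entries in the image of a subring `R`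
factors through `SL₂(R)`. -/
theorem Matrix.SpecialLinearGroup.exists_lift {R K A : Type*} [CommRing R] [CommRing K] [Group A]
    (φ : R →+* K) (hφ : Function.Injective φ) (f : A →* SpecialLinearGroup (Fin 2) K)
    (hf : ∀ a i j, (f a).1 i j ∈ φ.range) :
    ∃ ρ : A →* SpecialLinearGroup (Fin 2) R, ∀ a i j, φ ((ρ a).1 i j) = (f a).1 i j := by
  choose m hm using hf
  have ext' : ∀ M N : Matrix (Fin 2) (Fin 2) R, φ.mapMatrix M = φ.mapMatrix N → M = N :=
    fun M N h => Matrix.map_injective hφ h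
  have hmap : ∀ a, φ.mapMatrix (Matrix.of (m a)) = (f a).1 := fun a => by
    ext i j
    simp [hm]
  refine ⟨{ toFun := fun a => ⟨Matrix.of (m a), hφ ?_⟩, map_one' := ?_, map_mul' := ?_ }, ?_⟩
  · rw [RingHom.map_det, hmap, map_one, (f a).2]
  · exact Subtype.ext (ext' _ _ (by simp [hmap]))
  · intro a b
    refine Subtype.ext (ext' _ _ ?_)
    change _ = φ.mapMatrix (Matrix.of (m a) * Matrix.of (m b))
    simp only [hmap, map_mul, SpecialLinearGroup.coe_mul]
  · intro a i j
    exact hm a i j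

/-- An involution in `SL₂` has equal diagonal entries. -/
theorem Matrix.SpecialLinearGroup.apply_zero_zero_eq {R : Type*} [CommRing R]
    {g : SpecialLinearGroup (Fin 2) R} (hg : g * g = 1) : g.1 0 0 = g.1 1 1 := by
  have h : g⁻¹ = g := inv_eq_of_mul_eq_one_left hg
  have := congrArg (fun x : SpecialLinearGroup (Fin 2) R => x.1 1 1) h
  simpa [SpecialLinearGroup.coe_inv, Matrix.adjugate_fin_two] using this

/-- In characteristic two, an involution of `SL₂` with entries `1 + x` on the diagonal satisfies
`x² = βγ`, where `β` and `γ` are its off-diagonal entries. -/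
theorem Matrix.SpecialLinearGroup.sq_sub_one_eq {R : Type*} [CommRing R] (h2 : (2 : R) = 0)
    {g : SpecialLinearGroup (Fin 2) R} (hg : g * g = 1) :
    (g.1 0 0 - 1) ^ 2 = g.1 0 1 * g.1 1 0 := by
  have hd := g.2
  rw [Matrix.det_fin_two, ← apply_zero_zero_eq hg] at hd
  linear_combination hd + (1 - g.1 0 0) * h2

/-- In characteristic two, a diagonal involution of `SL₂` over a domain is trivial. -/
theorem Matrix.SpecialLinearGroup.eq_one_of_diagonal {R : Type*} [CommRing R] [IsDomain R]
    (h2 : (2 : R) = 0) {g : SpecialLinearGroup (Fin 2) R} (hg : g * g = 1)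
    (h01 : g.1 0 1 = 0) (h10 : g.1 1 0 = 0) : g = 1 := by
  have h := sq_sub_one_eq h2 hg
  rw [h01, zero_mul, sq_eq_zero_iff, sub_eq_zero] at h
  have h' := apply_zero_zero_eq hg
  ext i j
  fin_cases i <;> fin_cases j <;> simp_all

/-- If an involution in an odd dihedral group acting through `SL₂(F⟦X⟧)` in characteristic two
is diagonal modulo `X`, then the whole group is trivial modulo `X`. -/
theorem PowerSeries.constantCoeff_offDiag_eq_zero {F : Type*} [Field F] (h2 : (2 : F) = 0) {n : ℕ}
    (hn : Odd n) {A : Type*} [Group A] (e : A ≃* DihedralGroup n)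
    (ρ : A →* SpecialLinearGroup (Fin 2) (PowerSeries F)) {t : A} (ht : t ≠ 1) (ht2 : t * t = 1)
    (h01 : constantCoeff ((ρ t).1 0 1) = 0) (h10 : constantCoeff ((ρ t).1 1 0) = 0) (x : A) :
    constantCoeff ((ρ x).1 0 1) = 0 ∧ constantCoeff ((ρ x).1 1 0) = 0 := by
  let f : A →* SpecialLinearGroup (Fin 2) F :=
    (SpecialLinearGroup.map (constantCoeff (R := F))).comp ρ
  have hf : ∀ y i j, (f y).1 i j = constantCoeff ((ρ y).1 i j) := fun _ _ _ => rfl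
  have hft : f t = 1 := by
    apply SpecialLinearGroup.eq_one_of_diagonal h2
    · rw [← map_mul, ht2, map_one]
    · rw [hf, h01]
    · rw [hf, h10]
  have hx : f x = 1 := by
    have := DihedralGroup.map_eq_one_of_odd hn (f.comp e.symm.toMonoidHom) (t := e t)
      (by simpa using ht) (by rw [← map_mul, ht2, map_one]) (by simpa using hft) (e x)
    simpa using this
  rw [← hf, ← hf, hx]
  simp

/-- A product of two units of `F⟦X⟧` times `X` is never a square. -/
theorem PowerSeries.sq_ne_X_mul {F : Type*} [Field F] {b c : PowerSeries F}
    (hb : constantCoeff b ≠ 0) (hc : constantCoeff c ≠ 0) (x : PowerSeries F) :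
    x ^ 2 ≠ b * (X * c) := by
  intro h
  have hX : (X : PowerSeries F) ∣ x :=
    X_prime.dvd_of_dvd_pow (n := 2) (h ▸ ⟨b * c, by ring⟩)
  obtain ⟨y, rfl⟩ := hX
  have h' : X * y ^ 2 = b * c :=
    mul_left_cancel₀ X_ne_zero (by linear_combination h)
  have := congrArg (constantCoeff (R := F)) h'
  simp only [map_mul, constantCoeff_X, zero_mul] at this
  exact mul_ne_zero hb hc this.symm

/-- Let `q = 2^a`, `K = 𝔽_q((u))`, and `P₁, P₂, B` the standard
parahoric and Iwahori subgroups of `SL₂(K)`.  There are no subgroups `A₁ ≤ P₁`, `A₂ ≤ P₂`,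
each isomorphic to the dihedral group of order `2(q+1)`, with `A₁ ∩ A₂` of order `2`,
such that `P_i = A_i · B` and `A_i ∩ P_{3-i} = A₁ ∩ A₂` for `i = 1, 2`. -/
theorem no_dihedral_edge_transitive_lattice_char_two (a : ℕ) (ha : 1 ≤ a) :
    ¬ ∃ A₁ A₂ : Subgroup (Matrix.SpecialLinearGroup (Fin 2)
        (LaurentSeries (GaloisField 2 a))),
      Nonempty (A₁ ≃* DihedralGroup (2 ^ a + 1)) ∧
      Nonempty (A₂ ≃* DihedralGroup (2 ^ a + 1)) ∧
      Nat.card ↥(A₁ ⊓ A₂) = 2 ∧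
      (↑A₁ : Set _) ⊆ parahoricOne (GaloisField 2 a) ∧
      (↑A₂ : Set _) ⊆ parahoricTwo (GaloisField 2 a) ∧
      (∀ g ∈ parahoricOne (GaloisField 2 a),
        ∃ x ∈ A₁, ∃ b ∈ iwahori (GaloisField 2 a), g = x * b) ∧
      (∀ g ∈ parahoricTwo (GaloisField 2 a),
        ∃ x ∈ A₂, ∃ b ∈ iwahori (GaloisField 2 a), g = x * b) ∧
      (↑A₁ : Set _) ∩ parahoricTwo (GaloisField 2 a) = ↑(A₁ ⊓ A₂) ∧
      (↑A₂ : Set _) ∩ parahoricOne (GaloisField 2 a) = ↑(A₁ ⊓ A₂) := by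
  rintro ⟨A₁, A₂, ⟨e₁⟩, ⟨e₂⟩, hcard, h₁, h₂, -, -, hA₁, hA₂⟩
  have hodd : Odd (2 ^ a + 1) := ((even_two (α := ℕ)).pow_of_ne_zero (by omega)).add_one
  set F := GaloisField 2 a
  have h2 : (2 : F) = 0 := CharTwo.two_eq_zero
  have h2' : (2 : PowerSeries F) = 0 := by
    rw [← map_ofNat (PowerSeries.C (R := F)) 2, h2, map_zero]
  have hφ : Function.Injective (HahnSeries.ofPowerSeries ℤ F) :=
    HahnSeries.ofPowerSeries_injective
  have hu : laurentVar F ≠ 0 := fun h =>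
    PowerSeries.X_ne_zero (hφ (h.trans (map_zero _).symm))
  have ne_inf : ∀ A : Subgroup (SpecialLinearGroup (Fin 2) (LaurentSeries F)),
      Nonempty (A ≃* DihedralGroup (2 ^ a + 1)) → A ≠ A₁ ⊓ A₂ := by
    rintro A ⟨e⟩ rfl
    rw [Nat.card_congr e.toEquiv, DihedralGroup.nat_card] at hcard
    have := Nat.pow_pos (n := a) (show 0 < 2 by norm_num)
    omega
  obtain ⟨ρ₁, hρ₁⟩ := SpecialLinearGroup.exists_lift _ hφ A₁.subtype fun x i j => h₁ x.2 i j
  obtain ⟨ρ₂, hρ₂⟩ := SpecialLinearGroup.exists_lift _ hφ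
    ((SpecialLinearGroup.diagConj (laurentVar F) hu).comp A₂.subtype) (by
      intro x i j
      obtain ⟨h00, h11, h01, y, hy, h10⟩ := h₂ x.2
      have h10' : (laurentVar F)⁻¹ * x.1.1 1 0 ∈ laurentIntegers F := by
        rw [h10, inv_mul_cancel_left₀ hu]
        exact hy
      fin_cases i <;> fin_cases j
      exacts [h00, h01, h10', h11])
  obtain ⟨⟨t, ht₁, ht₂⟩, hne⟩ : ∃ t : ↥(A₁ ⊓ A₂), t ≠ 1 := by
    have : Nontrivial ↥(A₁ ⊓ A₂) := by
      have := Nat.finite_of_card_ne_zero (α := ↥(A₁ ⊓ A₂)) (by omega)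
      exact Finite.one_lt_card_iff_nontrivial.1 (by omega)
    exact exists_ne 1
  have hne' : t ≠ 1 := fun h => hne (Subtype.ext h)
  have htt : t * t = 1 := by
    have := pow_card_eq_one' (x := (⟨t, ht₁, ht₂⟩ : ↥(A₁ ⊓ A₂)))
    rw [hcard, sq] at this
    exact congrArg Subtype.val this
  set g := ρ₁ ⟨t, ht₁⟩ with hg
  set h := ρ₂ ⟨t, ht₂⟩ with hh
  have h01 : h.1 0 1 = PowerSeries.X * g.1 0 1 := hφ <| by
    rw [map_mul, hρ₁, hρ₂]
    rfl
  have h10 : g.1 1 0 = PowerSeries.X * h.1 1 0 := hφ <| by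
    rw [map_mul, hρ₁, hρ₂]
    exact (mul_inv_cancel_left₀ hu _).symm
  have hgg : g * g = 1 := by
    rw [hg, ← map_mul, ← map_one ρ₁]
    exact congrArg ρ₁ (Subtype.ext htt)
  refine PowerSeries.sq_ne_X_mul (b := g.1 0 1) (c := h.1 1 0) ?_ ?_ (g.1 0 0 - 1)
    (h10 ▸ SpecialLinearGroup.sq_sub_one_eq h2' hgg)
  · intro h0
    refine ne_inf A₁ ⟨e₁⟩ (SetLike.coe_injective ?_)
    rw [← hA₁, eq_comm, Set.inter_eq_left]
    intro x hx
    have key := PowerSeries.constantCoeff_offDiag_eq_zero h2 hodd e₁ ρ₁ (t := ⟨t, ht₁⟩)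
      (fun h => hne' (congrArg Subtype.val h)) (Subtype.ext htt) h0
      (by rw [← hg, h10]; simp) ⟨x, hx⟩
    obtain ⟨y, hy⟩ := PowerSeries.X_dvd_iff.2 key.2
    refine ⟨h₁ hx 0 0, h₁ hx 1 1, mul_mem ⟨_, rfl⟩ (h₁ hx 0 1), _, ⟨y, rfl⟩, ?_⟩
    exact (hρ₁ ⟨x, hx⟩ 1 0).symm.trans (by rw [hy, map_mul]; rfl)
  · intro h0
    refine ne_inf A₂ ⟨e₂⟩ (SetLike.coe_injective ?_)
    rw [← hA₂, eq_comm, Set.inter_eq_left]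
    intro x hx
    have key := PowerSeries.constantCoeff_offDiag_eq_zero h2 hodd e₂ ρ₂ (t := ⟨t, ht₂⟩)
      (fun h => hne' (congrArg Subtype.val h)) (Subtype.ext htt)
      (by rw [← hh, h01]; simp) h0 ⟨x, hx⟩
    obtain ⟨y, hy⟩ := PowerSeries.X_dvd_iff.2 key.1
    obtain ⟨hx00, hx11, -, z, hz, hx10⟩ := h₂ hx
    have hx01 : x.1 0 1 ∈ laurentIntegers F := by
      refine ⟨y, mul_left_cancel₀ hu ?_⟩
      have := hρ₂ ⟨x, hx⟩ 0 1
      rw [hy, map_mul] at this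
      exact this
    have hx10' : x.1 1 0 ∈ laurentIntegers F := by
      rw [hx10]
      exact mul_mem ⟨_, rfl⟩ hz
    intro i j
    fin_cases i <;> fin_cases j
    exacts [hx00, hx01, hx10', hx11]
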